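/- arXiv:2204.11537 — 10 statements merged into one kernel-verified Lean document; each statement's English description precedes it below -/
import Mathlib

section
/- Dissipation theorem for contact Hamiltonian systems (in Darboux coordinates): let H : ℝ^n × ℝ^n × ℝ → ℝ be C² and let X_H be its contact Hamiltonian vector field. If Y = (Y^q, Y^p, Y^s) is a C¹ vector field on ℝ^n × ℝ^n × ℝ that is an infinitesimal dynamical symmetry, i.e. [Y, X_H] = 0, then the function F(q,p,s) = Σᵢ pᵢ Y^{qᵢ}(q,p,s) − Y^s(q,p,s) (which equals −i(Y)η) is a dissipated quantity: for every point x, dF_x(X_H(x)) = −(∂H/∂s)(x) · F(x). -/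
open scoped BigOperators

/-- The contact Hamiltonian vector field `X_H` of a Hamiltonian `H` on the
canonical contact manifold `ℝ^n × ℝ^n × ℝ` in Darboux coordinates `(q, p, s)`. -/
noncomputable def contactHamVF {n : ℕ}
    (H : (Fin n → ℝ) × (Fin n → ℝ) × ℝ → ℝ) :
    (Fin n → ℝ) × (Fin n → ℝ) × ℝ → (Fin n → ℝ) × (Fin n → ℝ) × ℝ :=
  fun x =>
    ((fun i => fderiv ℝ H x (0, Pi.single i (1:ℝ), 0)),
     (fun i => -(fderiv ℝ H x (Pi.single i (1:ℝ), 0, 0)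
        + x.2.1 i * fderiv ℝ H x (0, 0, 1))),
     (∑ i, x.2.1 i * fderiv ℝ H x (0, Pi.single i (1:ℝ), 0)) - H x)

/-- Product rule for minus the contraction of the contact form with a vector field `V`. -/
theorem fderiv_sum_mul_sub_apply {n : ℕ}
    {V : (Fin n → ℝ) × (Fin n → ℝ) × ℝ → (Fin n → ℝ) × (Fin n → ℝ) × ℝ}
    {x : (Fin n → ℝ) × (Fin n → ℝ) × ℝ} (hV : DifferentiableAt ℝ V x)
    (v : (Fin n → ℝ) × (Fin n → ℝ) × ℝ) :
    fderiv ℝ (fun y => (∑ i, y.2.1 i * (V y).1 i) - (V y).2.2) x v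
      = (∑ i, v.2.1 i * (V x).1 i)
        + ((∑ i, x.2.1 i * (fderiv ℝ V x v).1 i) - (fderiv ℝ V x v).2.2) := by
  have hp (i : Fin n) : HasFDerivAt
      (fun y : (Fin n → ℝ) × (Fin n → ℝ) × ℝ => y.2.1 i) _ x :=
    (ContinuousLinearMap.proj (R := ℝ) (φ := fun _ : Fin n => ℝ) i).hasFDerivAt.comp x
      (hasFDerivAt_snd.fst : HasFDerivAt (fun y : (Fin n → ℝ) × (Fin n → ℝ) × ℝ => y.2.1) _ x)
  have hq (i : Fin n) : HasFDerivAt (fun y => (V y).1 i) _ x :=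
    (ContinuousLinearMap.proj (R := ℝ) (φ := fun _ : Fin n => ℝ) i).hasFDerivAt.comp x
      hV.hasFDerivAt.fst
  have h := (HasFDerivAt.fun_sum fun i (_ : i ∈ Finset.univ) => (hp i).fun_mul (hq i)).fun_sub
    hV.hasFDerivAt.snd.snd
  rw [h.fderiv]
  simp only [sub_apply, sum_apply, add_apply, smul_apply,
    ContinuousLinearMap.comp_apply, ContinuousLinearMap.proj_apply,
    ContinuousLinearMap.coe_fst', ContinuousLinearMap.coe_snd', smul_eq_mul,
    Finset.sum_add_distrib]
  simp only [mul_comm ((V x).1 _)]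
  ring

/-- A linear functional on `ℝ^n × ℝ^n × ℝ` in terms of its values on the coordinate vectors. -/
theorem clm_apply_eq_sum_single {n : ℕ} (L : (Fin n → ℝ) × (Fin n → ℝ) × ℝ →L[ℝ] ℝ)
    (v : (Fin n → ℝ) × (Fin n → ℝ) × ℝ) :
    L v = (∑ i, v.1 i * L (Pi.single i 1, 0, 0)) + (∑ i, v.2.1 i * L (0, Pi.single i 1, 0))
      + v.2.2 * L (0, 0, 1) := by
  have h : v = (∑ i, v.1 i • ((Pi.single i 1, 0, 0) : (Fin n → ℝ) × (Fin n → ℝ) × ℝ))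
      + (∑ i, v.2.1 i • ((0, Pi.single i 1, 0) : (Fin n → ℝ) × (Fin n → ℝ) × ℝ))
      + v.2.2 • ((0, 0, 1) : (Fin n → ℝ) × (Fin n → ℝ) × ℝ) := by
    ext <;> simp [Prod.fst_sum, Prod.snd_sum, Finset.sum_apply, Pi.single_apply]
  conv_lhs => rw [h]
  simp only [map_add, map_sum, map_smul, smul_eq_mul]

theorem differentiable_contactHamVF {n : ℕ} {H : (Fin n → ℝ) × (Fin n → ℝ) × ℝ → ℝ}
    (hH : ContDiff ℝ 2 H) : Differentiable ℝ (contactHamVF H) := by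
  have hH' : Differentiable ℝ H := hH.differentiable (by norm_num)
  have hD : Differentiable ℝ (fderiv ℝ H) :=
    (hH.fderiv_right (m := 1) (by norm_num)).differentiable (by norm_num)
  unfold contactHamVF
  fun_prop

/-- **Dissipation theorem for contact Hamiltonian systems** (in Darboux
coordinates): if `Y` is a `C¹` infinitesimal dynamical symmetry, `[Y, X_H] = 0`,
then `F = Σᵢ pᵢ Y^{qᵢ} − Y^s = −i(Y)η` is a dissipated quantity:
`dF_x(X_H(x)) = −(∂H/∂s)(x) · F(x)`. -/
theorem dissipation_theorem_contact {n : ℕ}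
    (H : (Fin n → ℝ) × (Fin n → ℝ) × ℝ → ℝ) (hH : ContDiff ℝ 2 H)
    (Y : (Fin n → ℝ) × (Fin n → ℝ) × ℝ → (Fin n → ℝ) × (Fin n → ℝ) × ℝ)
    (hY : ContDiff ℝ 1 Y)
    (hsym : ∀ x, fderiv ℝ (contactHamVF H) x (Y x)
        - fderiv ℝ Y x (contactHamVF H x) = 0)
    (F : (Fin n → ℝ) × (Fin n → ℝ) × ℝ → ℝ)
    (hF : ∀ x, F x = (∑ i, x.2.1 i * (Y x).1 i) - (Y x).2.2) :
    ∀ x, fderiv ℝ F x (contactHamVF H x)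
      = -(fderiv ℝ H x (0, 0, 1)) * F x := by
  intro x
  have hX := differentiable_contactHamVF hH x
  have hXH : (fun y => (∑ i, y.2.1 i * (contactHamVF H y).1 i) - (contactHamVF H y).2.2) = H := by
    ext y
    simp [contactHamVF]
  have hdH := fderiv_sum_mul_sub_apply hX (Y x)
  rw [hXH, clm_apply_eq_sum_single, sub_eq_zero.1 (hsym x)] at hdH
  rw [hF x, funext hF, fderiv_sum_mul_sub_apply (hY.differentiable (by norm_num) x)]
  have hpq : ∑ i, (contactHamVF H x).2.1 i * (Y x).1 i
      = -(∑ i, (Y x).1 i * fderiv ℝ H x (Pi.single i 1, 0, 0))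
        - fderiv ℝ H x (0, 0, 1) * ∑ i, x.2.1 i * (Y x).1 i := by
    rw [Finset.mul_sum, ← Finset.sum_neg_distrib, ← Finset.sum_sub_distrib]
    refine Finset.sum_congr rfl fun i _ => ?_
    simp only [contactHamVF]
    ring
  have hqp : ∑ i, (Y x).2.1 i * (contactHamVF H x).1 i
      = ∑ i, (Y x).2.1 i * fderiv ℝ H x (0, Pi.single i 1, 0) := rfl
  linear_combination hpq - hdH - hqp
end

section
/- Dissipation theorem for k-contact Hamiltonian systems (in Darboux coordinates): let H : ℝ^n × ℝ^{nk} × ℝ^k → ℝ be C², with coordinates (qⁱ, pᵢ^α, s^α), i = 1,…,n, α = 1,…,k. Let X₁, …, X_k be C¹ vector fields on ℝ^n × ℝ^{nk} × ℝ^k, with components ((X_α)^{qⁱ}, (X_α)^{pᵢ^β}, (X_α)^{s^β}), satisfying at every point the coordinate Hamilton–De Donder–Weyl conditions: (X_α)^{qⁱ} = ∂H/∂pᵢ^α for all α, i; Σ_α (X_α)^{pᵢ^α} = −(∂H/∂qⁱ + Σ_α pᵢ^α ∂H/∂s^α) for all i; and Σ_α (X_α)^{s^α} = Σ_{i,α}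 pᵢ^α ∂H/∂pᵢ^α − H. If Y is a C¹ vector field with [Y, X_α] = 0 for every α, then the functions F^α := Σᵢ pᵢ^α Y^{qⁱ} − Y^{s^α} (i.e. F^α = −i(Y)η^α) satisfy the dissipation law for k-vector fields: Σ_α d(F^α)_x(X_α(x)) = −Σ_α (∂H/∂s^α)(x) · F^α(x) at every point x. -/
open scoped BigOperators

/-- Expansion of a linear functional on `ℝ^n × ℝ^{nk} × ℝ^k` in the Darboux coordinate basis. -/
theorem darboux_linear_apply {n k : ℕ}
    (L : (Fin n → ℝ) × (Fin n → Fin k → ℝ) × (Fin k → ℝ) →L[ℝ] ℝ)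
    (v : (Fin n → ℝ) × (Fin n → Fin k → ℝ) × (Fin k → ℝ)) :
    L v = (∑ i, v.1 i * L (Pi.single i (1 : ℝ), 0, 0))
      + (∑ i, ∑ α, v.2.1 i α * L (0, Pi.single i (Pi.single α (1 : ℝ)), 0))
      + ∑ α, v.2.2 α * L (0, 0, Pi.single α (1 : ℝ)) := by
  have hv : v = (∑ i, v.1 i • ((Pi.single i (1 : ℝ), 0, 0) :
        (Fin n → ℝ) × (Fin n → Fin k → ℝ) × (Fin k → ℝ)))
      + (∑ i, ∑ α, v.2.1 i α • ((0, Pi.single i (Pi.single α (1 : ℝ)), 0) :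
        (Fin n → ℝ) × (Fin n → Fin k → ℝ) × (Fin k → ℝ)))
      + ∑ α, v.2.2 α • ((0, 0, Pi.single α (1 : ℝ)) :
        (Fin n → ℝ) × (Fin n → Fin k → ℝ) × (Fin k → ℝ)) := by
    refine Prod.ext ?_ (Prod.ext ?_ ?_)
    · ext j
      simp [Prod.fst_sum, Finset.sum_apply, Pi.single_apply]
    · ext j β
      simp only [Prod.snd_add, Prod.fst_add, Prod.snd_sum, Prod.fst_sum, Prod.smul_mk, smul_zero,
        Finset.sum_const_zero, Pi.add_apply, Pi.zero_apply, zero_add, add_zero, Finset.sum_apply,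
        Pi.smul_apply, smul_eq_mul]
      rw [Finset.sum_eq_single j]
      · simp [Pi.single_apply]
      · intro i _ hij
        simp [Pi.single_eq_of_ne' hij]
      · simp
    · ext β
      simp [Prod.snd_sum, Finset.sum_apply, Pi.single_apply]
  conv_lhs => rw [hv]
  simp only [map_add, map_sum, map_smul, smul_eq_mul]

/-- The derivative of a coordinate pairing `Σᵢ pᵢ^α V^{qⁱ}` in terms of the derivative of `V`. -/
theorem exists_hasFDerivAt_momentum_pairing {n k : ℕ}
    {V : (Fin n → ℝ) × (Fin n → Fin k → ℝ) × (Fin k → ℝ) →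
      (Fin n → ℝ) × (Fin n → Fin k → ℝ) × (Fin k → ℝ)}
    {x : (Fin n → ℝ) × (Fin n → Fin k → ℝ) × (Fin k → ℝ)}
    (hV : DifferentiableAt ℝ V x) (α : Fin k) :
    ∃ L : (Fin n → ℝ) × (Fin n → Fin k → ℝ) × (Fin k → ℝ) →L[ℝ] ℝ,
      HasFDerivAt (fun y => ∑ i, y.2.1 i α * (V y).1 i) L x ∧
      ∀ v, L v = ∑ i, (x.2.1 i α * (fderiv ℝ V x v).1 i + v.2.1 i α * (V x).1 i) := by
  have hp (i : Fin n) := hasFDerivAt_pi'.1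
    (hasFDerivAt_pi'.1 (hasFDerivAt_id (𝕜 := ℝ) x).snd.fst i) α
  have hq (i : Fin n) := hasFDerivAt_pi'.1 hV.hasFDerivAt.fst i
  refine ⟨_, HasFDerivAt.fun_sum fun i _ => (hp i).mul (hq i), fun v => ?_⟩
  simp [mul_comm]

/-- The derivative of the component `V^{s^α}` in terms of the derivative of `V`. -/
theorem exists_hasFDerivAt_action_component {n k : ℕ}
    {V : (Fin n → ℝ) × (Fin n → Fin k → ℝ) × (Fin k → ℝ) →
      (Fin n → ℝ) × (Fin n → Fin k → ℝ) × (Fin k → ℝ)}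
    {x : (Fin n → ℝ) × (Fin n → Fin k → ℝ) × (Fin k → ℝ)}
    (hV : DifferentiableAt ℝ V x) (α : Fin k) :
    ∃ L : (Fin n → ℝ) × (Fin n → Fin k → ℝ) × (Fin k → ℝ) →L[ℝ] ℝ,
      HasFDerivAt (fun y => (V y).2.2 α) L x ∧ ∀ v, L v = (fderiv ℝ V x v).2.2 α :=
  ⟨_, hasFDerivAt_pi'.1 hV.hasFDerivAt.snd.snd α, fun _ => rfl⟩

/-- **Dissipation theorem for k-contact Hamiltonian systems** (in Darboux
coordinates `(qⁱ, pᵢ^α, s^α)` on `ℝ^n × ℝ^{nk} × ℝ^k`): if `(X_α)` is a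
`C¹` solution of the Hamilton–De Donder–Weyl equations for a `C²` Hamiltonian
`H` and `Y` is a `C¹` vector field with `[Y, X_α] = 0` for all `α`, then the
functions `F^α = Σᵢ pᵢ^α Y^{qⁱ} − Y^{s^α} = −i(Y)η^α` satisfy the dissipation
law `Σ_α d(F^α)_x(X_α x) = −Σ_α (∂H/∂s^α)(x) · F^α(x)`. -/
theorem dissipation_theorem_k_contact {n k : ℕ}
    (H : (Fin n → ℝ) × (Fin n → Fin k → ℝ) × (Fin k → ℝ) → ℝ)
    (hH : ContDiff ℝ 2 H)
    (X : Fin k → (Fin n → ℝ) × (Fin n → Fin k → ℝ) × (Fin k → ℝ) →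
      (Fin n → ℝ) × (Fin n → Fin k → ℝ) × (Fin k → ℝ))
    (hX : ∀ α, ContDiff ℝ 1 (X α))
    (hXq : ∀ α x i, (X α x).1 i
      = fderiv ℝ H x (0, Pi.single i (Pi.single α (1:ℝ)), 0))
    (hXp : ∀ x i, (∑ α, (X α x).2.1 i α)
      = -(fderiv ℝ H x (Pi.single i (1:ℝ), 0, 0)
          + ∑ α, x.2.1 i α * fderiv ℝ H x (0, 0, Pi.single α (1:ℝ))))
    (hXs : ∀ x, (∑ α, (X α x).2.2 α)
      = (∑ i, ∑ α, x.2.1 i α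
          * fderiv ℝ H x (0, Pi.single i (Pi.single α (1:ℝ)), 0)) - H x)
    (Y : (Fin n → ℝ) × (Fin n → Fin k → ℝ) × (Fin k → ℝ) →
      (Fin n → ℝ) × (Fin n → Fin k → ℝ) × (Fin k → ℝ))
    (hY : ContDiff ℝ 1 Y)
    (hsym : ∀ α x, fderiv ℝ (X α) x (Y x) - fderiv ℝ Y x (X α x) = 0)
    (F : Fin k → (Fin n → ℝ) × (Fin n → Fin k → ℝ) × (Fin k → ℝ) → ℝ)
    (hF : ∀ α x, F α x = (∑ i, x.2.1 i α * (Y x).1 i) - (Y x).2.2 α) :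
    ∀ x, (∑ α, fderiv ℝ (F α) x (X α x))
      = -∑ α, fderiv ℝ H x (0, 0, Pi.single α (1:ℝ)) * F α x := by
  intro x
  have hYx : DifferentiableAt ℝ Y x := hY.differentiable one_ne_zero x
  have hXx (α : Fin k) : DifferentiableAt ℝ (X α) x := (hX α).differentiable one_ne_zero x
  have hHx : HasFDerivAt H (fderiv ℝ H x) x := (hH.differentiable two_ne_zero x).hasFDerivAt
  have hbracket (α : Fin k) : fderiv ℝ Y x (X α x) = fderiv ℝ (X α) x (Y x) :=
    (sub_eq_zero.1 (hsym α x)).symm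
  have hdF (α : Fin k) : fderiv ℝ (F α) x (X α x)
      = (∑ i, (x.2.1 i α * (fderiv ℝ (X α) x (Y x)).1 i + (X α x).2.1 i α * (Y x).1 i))
        - (fderiv ℝ (X α) x (Y x)).2.2 α := by
    obtain ⟨L, hL, hLv⟩ := exists_hasFDerivAt_momentum_pairing hYx α
    obtain ⟨M, hM, hMv⟩ := exists_hasFDerivAt_action_component hYx α
    rw [funext (hF α), (hL.fun_sub hM).fderiv, sub_apply, hLv, hMv, hbracket]
  have hdXs : ∑ α, (fderiv ℝ (X α) x (Y x)).2.2 α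
      = (∑ α, ∑ i, (x.2.1 i α * (fderiv ℝ (X α) x (Y x)).1 i + (Y x).2.1 i α * (X α x).1 i))
        - fderiv ℝ H x (Y x) := by
    choose L hL hLv using fun α => exists_hasFDerivAt_momentum_pairing (hXx α) α
    choose M hM hMv using fun α => exists_hasFDerivAt_action_component (hXx α) α
    have hfun : (fun y => ∑ α, (X α y).2.2 α)
        = fun y => (∑ α, ∑ i, y.2.1 i α * (X α y).1 i) - H y := by
      funext y
      rw [hXs, Finset.sum_comm]
      simp only [hXq]
    have hleft := HasFDerivAt.fun_sum (u := Finset.univ) fun α _ => hM α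
    rw [hfun] at hleft
    have h := congrArg (fun T => T (Y x)) (hleft.unique
      ((HasFDerivAt.fun_sum (u := Finset.univ) fun α _ => hL α).fun_sub hHx))
    simpa only [sum_apply, sub_apply, hLv, hMv] using h
  have hXpY : ∑ α, ∑ i, (X α x).2.1 i α * (Y x).1 i
      = -(∑ i, (Y x).1 i * fderiv ℝ H x (Pi.single i (1 : ℝ), 0, 0))
        - ∑ α, fderiv ℝ H x (0, 0, Pi.single α (1 : ℝ)) * ∑ i, x.2.1 i α * (Y x).1 i := by
    rw [Finset.sum_comm]
    simp only [← Finset.sum_mul, hXp, Finset.mul_sum]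
    rw [Finset.sum_comm (s := (Finset.univ : Finset (Fin k))), ← Finset.sum_neg_distrib,
      ← Finset.sum_sub_distrib]
    refine Finset.sum_congr rfl fun i _ => ?_
    rw [neg_mul, add_mul, Finset.sum_mul, neg_add, mul_comm, ← sub_eq_add_neg]
    congr 1
    exact Finset.sum_congr rfl fun α _ => by ring
  have hYp : ∑ α, ∑ i, (Y x).2.1 i α * (X α x).1 i
      = ∑ i, ∑ α, (Y x).2.1 i α
          * fderiv ℝ H x (0, Pi.single i (Pi.single α (1 : ℝ)), 0) := by
    rw [Finset.sum_comm]
    simp only [hXq]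
  have hYs : ∑ α, fderiv ℝ H x (0, 0, Pi.single α (1 : ℝ)) * (Y x).2.2 α
      = ∑ α, (Y x).2.2 α * fderiv ℝ H x (0, 0, Pi.single α (1 : ℝ)) :=
    Finset.sum_congr rfl fun α _ => mul_comm _ _
  have hHY := darboux_linear_apply (fderiv ℝ H x) (Y x)
  simp only [hdF, hF, mul_sub, Finset.sum_sub_distrib, Finset.sum_add_distrib] at hdXs ⊢
  linarith
end

section
/- Reeb vector field identity for regular contact Lagrangians (in coordinates): let L : ℝ^n × ℝ^n × ℝ → ℝ be C² in coordinates (qⁱ, vⁱ, s), and suppose L is regular in the sense that there exists W : ℝ^n × ℝ^n × ℝ → (n×n matrices over ℝ) with Σⱼ W^{ij} ∂²L/∂vʲ∂v^k = δ^i_k at every point (W is the inverse of the fibre Hessian of L). Define the Lagrangian energy E_L = Σᵢ vⁱ ∂L/∂vⁱ − L. Then the Reeb vector field R_L = ∂/∂s − Σ_{i,j} W^{ji} (∂²L/∂s∂vʲ) ∂/∂vⁱ satisfies R_L(E_L) = −∂L/∂s; explicitly, ∂E_L/∂s − Σ_{i,j} W^{ji} (∂²L/∂s∂vʲ)(∂E_L/∂vⁱ)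 = −∂L/∂s at every point. -/
open scoped BigOperators

/-- The differential of the Lagrangian energy `Σᵢ vⁱ ∂L/∂vⁱ − L` of a `C²` function `L`. -/
theorem fderiv_lagrangianEnergy_apply {n : ℕ}
    {L : (Fin n → ℝ) × (Fin n → ℝ) × ℝ → ℝ} (hL : ContDiff ℝ 2 L)
    (x w : (Fin n → ℝ) × (Fin n → ℝ) × ℝ) :
    fderiv ℝ (fun y => (∑ i, y.2.1 i * fderiv ℝ L y (0, Pi.single i (1:ℝ), 0)) - L y) x w
      = (∑ i, (x.2.1 i * fderiv ℝ (fun y => fderiv ℝ L y (0, Pi.single i (1:ℝ), 0)) x w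
          + w.2.1 i * fderiv ℝ L x (0, Pi.single i (1:ℝ), 0))) - fderiv ℝ L x w := by
  have hL' : Differentiable ℝ (fderiv ℝ L) :=
    (hL.fderiv_right (m := 1) (by norm_num)).differentiable (by norm_num)
  have hpartial (i : Fin n) :
      DifferentiableAt ℝ (fun y => fderiv ℝ L y (0, Pi.single i (1:ℝ), 0)) x :=
    (hL' x).clm_apply (differentiableAt_const _)
  have hcoord (i : Fin n) :
      HasFDerivAt (fun y : (Fin n → ℝ) × (Fin n → ℝ) × ℝ => y.2.1 i)
        ((ContinuousLinearMap.proj (R := ℝ) (φ := fun _ : Fin n => ℝ) i).comp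
          ((ContinuousLinearMap.fst ℝ (Fin n → ℝ) ℝ).comp
            (ContinuousLinearMap.snd ℝ (Fin n → ℝ) ((Fin n → ℝ) × ℝ)))) x :=
    ((ContinuousLinearMap.proj (R := ℝ) (φ := fun _ : Fin n => ℝ) i).comp
      ((ContinuousLinearMap.fst ℝ (Fin n → ℝ) ℝ).comp
        (ContinuousLinearMap.snd ℝ (Fin n → ℝ) ((Fin n → ℝ) × ℝ)))).hasFDerivAt
  have hE := (HasFDerivAt.fun_sum (u := Finset.univ)
    fun i _ => (hcoord i).mul (hpartial i).hasFDerivAt).sub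
      (hL.differentiable (by norm_num) x).hasFDerivAt
  refine (congrArg (fun T => T w) hE.fderiv).trans ?_
  simp [mul_comm]

/-- **Reeb vector field identity for regular contact Lagrangians** (in
coordinates `(qⁱ, vⁱ, s)`): if `L` is `C²` and `W` is a pointwise inverse of
the fibre Hessian `∂²L/∂vⁱ∂vʲ`, then the Reeb vector field
`R_L = ∂/∂s − W^{ji}(∂²L/∂s∂vʲ)∂/∂vⁱ` applied to the Lagrangian energy
`E_L = Σᵢ vⁱ ∂L/∂vⁱ − L` gives `R_L(E_L) = −∂L/∂s`. -/
theorem reeb_of_lagrangian_energy {n : ℕ}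
    (L : (Fin n → ℝ) × (Fin n → ℝ) × ℝ → ℝ) (hL : ContDiff ℝ 2 L)
    (W : (Fin n → ℝ) × (Fin n → ℝ) × ℝ → Fin n → Fin n → ℝ)
    (hW : ∀ x i k, (∑ j, W x i j *
        fderiv ℝ (fun y => fderiv ℝ L y (0, Pi.single k (1:ℝ), 0)) x
          (0, Pi.single j (1:ℝ), 0))
      = if i = k then (1:ℝ) else 0)
    (EL : (Fin n → ℝ) × (Fin n → ℝ) × ℝ → ℝ)
    (hEL : ∀ x, EL x
      = (∑ i, x.2.1 i * fderiv ℝ L x (0, Pi.single i (1:ℝ), 0)) - L x) :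
    ∀ x, fderiv ℝ EL x (0, 0, 1)
        - (∑ i, ∑ j, W x j i *
            fderiv ℝ (fun y => fderiv ℝ L y (0, Pi.single j (1:ℝ), 0)) x (0, 0, 1)
            * fderiv ℝ EL x (0, Pi.single i (1:ℝ), 0))
      = -(fderiv ℝ L x (0, 0, 1)) := by
  intro x
  obtain rfl : EL = fun y =>
      (∑ i, y.2.1 i * fderiv ℝ L y (0, Pi.single i (1:ℝ), 0)) - L y := funext hEL
  have hv (k : Fin n) :
      fderiv ℝ (fun y => (∑ i, y.2.1 i * fderiv ℝ L y (0, Pi.single i (1:ℝ), 0)) - L y) x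
          (0, Pi.single k (1:ℝ), 0)
        = ∑ i, x.2.1 i * fderiv ℝ (fun y => fderiv ℝ L y (0, Pi.single i (1:ℝ), 0)) x
            (0, Pi.single k (1:ℝ), 0) := by
    rw [fderiv_lagrangianEnergy_apply hL, Finset.sum_add_distrib]
    simp [Pi.single_apply]
  have hs := fderiv_lagrangianEnergy_apply hL x (0, 0, 1)
  simp only [Pi.zero_apply, zero_mul, add_zero] at hs
  rw [hs]
  simp only [hv]
  set S : Fin n → ℝ := fun j =>
    fderiv ℝ (fun y => fderiv ℝ L y (0, Pi.single j (1:ℝ), 0)) x (0, 0, 1)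
  set H : Fin n → Fin n → ℝ := fun k i =>
    fderiv ℝ (fun y => fderiv ℝ L y (0, Pi.single i (1:ℝ), 0)) x
      (0, Pi.single k (1:ℝ), 0)
  have hWH (j i : Fin n) : ∑ k, W x j k * H k i = if j = i then (1:ℝ) else 0 := hW x j i
  have hsum : ∑ k, ∑ j, W x j k * S j * ∑ i, x.2.1 i * H k i = ∑ i, x.2.1 i * S i := by
    calc ∑ k, ∑ j, W x j k * S j * ∑ i, x.2.1 i * H k i
        = ∑ j, ∑ i, S j * x.2.1 i * ∑ k, W x j k * H k i := by
          rw [Finset.sum_comm]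
          refine Finset.sum_congr rfl fun j _ => ?_
          simp only [Finset.mul_sum]
          rw [Finset.sum_comm]
          exact Finset.sum_congr rfl fun i _ => Finset.sum_congr rfl fun k _ => by ring
      _ = ∑ i, x.2.1 i * S i := by
          simp [hWH, mul_comm]
  linarith
end

section
/- Dissipated and conserved quantities for motion in a constant gravitational field with friction: let m > 0 and g, γ ∈ ℝ. Suppose x, y : ℝ → ℝ are twice differentiable and s : ℝ → ℝ is differentiable with x'' = −γ x', y'' = −γ y' − g, and s' = (1/2) m (x'² + y'²) − m g y − γ s. Define the energy E(t) = (1/2) m (x'(t)² + y'(t)²) + m g y(t) + γ s(t) and the momentum p(t) = m x'(t). Then: (1) E'(t) = −γ E(t) for all t (energy dissipation); (2) p'(t) = −γ p(t) for all t (momentum dissipation); and (3) on any interval where x' is nonvanishing, the conserved quantity G = E / (m x') is constant, i.e. G'(t) = 0. -/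
/-- The quotient of two quantities dissipated at the same rate is conserved. -/
theorem HasDerivAt.div_of_dissipated {𝕜 : Type*} [NontriviallyNormedField 𝕜]
    {f h : 𝕜 → 𝕜} {c t : 𝕜} (hf : HasDerivAt f (c * f t) t)
    (hh : HasDerivAt h (c * h t) t) (h0 : h t ≠ 0) :
    HasDerivAt (fun τ => f τ / h τ) 0 t := by
  refine (hf.fun_div hh h0).congr_deriv ?_
  rw [div_eq_zero_iff]
  left
  ring

/-- **Dissipated and conserved quantities for motion in a constant
gravitational field with friction**: along solutions of `ẍ = −γẋ`,
`ÿ = −γẏ − g`, `ṡ = (1/2)m(ẋ² + ẏ²) − mgy − γs`, the energy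
`E = (1/2)m(ẋ² + ẏ²) + mgy + γs` and the momentum `p = mẋ` are dissipated
with rate `−γ`, and wherever `ẋ ≠ 0` the quotient `G = E/(mẋ)` is conserved. -/
theorem constant_gravity_with_friction (m g γ : ℝ) (hm : 0 < m)
    (x y s : ℝ → ℝ)
    (hx : Differentiable ℝ x) (hx' : Differentiable ℝ (deriv x))
    (hy : Differentiable ℝ y) (hy' : Differentiable ℝ (deriv y))
    (hs : Differentiable ℝ s)
    (heqx : ∀ t, deriv (deriv x) t = -γ * deriv x t)
    (heqy : ∀ t, deriv (deriv y) t = -γ * deriv y t - g)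
    (heqs : ∀ t, deriv s t
      = (1/2) * m * ((deriv x t) ^ 2 + (deriv y t) ^ 2) - m * g * y t - γ * s t)
    (E P : ℝ → ℝ)
    (hE : ∀ t, E t
      = (1/2) * m * ((deriv x t) ^ 2 + (deriv y t) ^ 2) + m * g * y t + γ * s t)
    (hP : ∀ t, P t = m * deriv x t) :
    (∀ t, deriv E t = -γ * E t)
    ∧ (∀ t, deriv P t = -γ * P t)
    ∧ (∀ t, deriv x t ≠ 0 →
        deriv (fun τ => E τ / (m * deriv x τ)) t = 0) := by
  have hEd (t : ℝ) : HasDerivAt E (-γ * E t) t := by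
    have hvx := (hx' t).hasDerivAt.fun_pow 2
    have hvy := (hy' t).hasDerivAt.fun_pow 2
    rw [funext hE]
    refine ((((hvx.fun_add hvy).const_mul ((1/2) * m)).fun_add
      ((hy t).hasDerivAt.const_mul (m * g))).fun_add
      ((hs t).hasDerivAt.const_mul γ)).congr_deriv ?_
    rw [heqx, heqy, heqs]
    push_cast
    ring
  have hPd (t : ℝ) : HasDerivAt P (-γ * P t) t := by
    rw [funext hP]
    refine ((hx' t).hasDerivAt.const_mul m).congr_deriv ?_
    rw [heqx]
    ring
  refine ⟨fun t => (hEd t).deriv, fun t => (hPd t).deriv, fun t ht => ?_⟩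
  simp only [← hP]
  refine ((hEd t).div_of_dissipated (hPd t) ?_).deriv
  rw [hP]
  exact mul_ne_zero hm.ne' ht
end

section
/- Energy dissipation for the parachute equation: let m > 0, g ∈ ℝ, and γ ≠ 0. If y : ℝ → ℝ is twice differentiable and satisfies the parachute equation y''(t) = γ y'(t)² − g for all t, then the Lagrangian energy E(t) = (1/2) m y'(t)² + (m g / (2γ)) (e^{2γ y(t)} − 1) satisfies E'(t) = 2γ y'(t) E(t) for all t. -/
/-- **Energy dissipation for the parachute equation**: if `y'' = γ(y')² − g`,
then the Lagrangian energy `E = (1/2)m(y')² + (mg/(2γ))(e^{2γy} − 1)` satisfies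
`E' = 2γ y' E`. -/
theorem parachute_energy_dissipation (m g γ : ℝ) (hm : 0 < m) (hγ : γ ≠ 0)
    (y : ℝ → ℝ) (hy : Differentiable ℝ y) (hy' : Differentiable ℝ (deriv y))
    (heq : ∀ t, deriv (deriv y) t = γ * (deriv y t) ^ 2 - g)
    (E : ℝ → ℝ)
    (hE : ∀ t, E t = (1/2) * m * (deriv y t) ^ 2
      + (m * g / (2 * γ)) * (Real.exp (2 * γ * y t) - 1)) :
    ∀ t, deriv E t = 2 * γ * deriv y t * E t := by
  intro t
  have hE_deriv : HasDerivAt E ((1/2) * m * (2 * deriv y t * deriv (deriv y) t)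
      + (m * g / (2 * γ)) * (Real.exp (2 * γ * y t) * (2 * γ * deriv y t))) t := by
    rw [funext hE]
    have hsq : HasDerivAt (fun t => deriv y t ^ 2) (2 * deriv y t * deriv (deriv y) t) t := by
      simpa using (hy' t).hasDerivAt.fun_pow 2
    have hexp := ((hy t).hasDerivAt.const_mul (2 * γ)).exp
    exact (hsq.const_mul _).add ((hexp.sub_const 1).const_mul _)
  rw [hE_deriv.deriv, hE, heq]
  field_simp
  ring
end

section
/- Energy dissipation for a central force with friction: let m > 0, γ ∈ ℝ, and U : ℝ → ℝ be C¹. Suppose q : ℝ → ℝ³ is a twice differentiable curve with q(t) ≠ 0 for all t, and s : ℝ → ℝ is differentiable, satisfying m q''(t) = −γ m q'(t) − (U'(‖q(t)‖)/‖q(t)‖) q(t) and s'(t) = (1/2) m ‖q'(t)‖² − U(‖q(t)‖) − γ s(t), where ‖·‖ is the Euclidean norm. Then the energy E(t) = (1/2) m ‖q'(t)‖² + U(‖q(t)‖) + γ s(t) satisfies E'(t) = −γ E(t) for all t. -/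
/-- The derivative of the norm of a curve at a point where it does not vanish. -/
theorem hasDerivAt_norm_of_ne_zero {F : Type*} [NormedAddCommGroup F] [InnerProductSpace ℝ F]
    {f : ℝ → F} {f' : F} {t : ℝ} (hf : HasDerivAt f f' t) (h0 : f t ≠ 0) :
    HasDerivAt (fun x => ‖f x‖) (inner ℝ (f t) f' / ‖f t‖) t := by
  have h := hf.norm_sq.sqrt (pow_ne_zero 2 (norm_ne_zero_iff.mpr h0))
  simp only [Real.sqrt_sq (norm_nonneg _)] at h
  convert h using 1
  rw [mul_div_mul_left _ _ two_ne_zero]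

/-- **Energy dissipation for a central force with friction**: if a twice
differentiable curve `q` in `ℝ³ ∖ {0}` satisfies
`m q'' = −γ m q' − (U'(‖q‖)/‖q‖) q` and `s' = (1/2)m‖q'‖² − U(‖q‖) − γs`, then
the energy `E = (1/2)m‖q'‖² + U(‖q‖) + γs` satisfies `E' = −γE`. -/
theorem central_force_energy_dissipation (m γ : ℝ) (hm : 0 < m)
    (U : ℝ → ℝ) (hU : ContDiff ℝ 1 U)
    (q : ℝ → EuclideanSpace ℝ (Fin 3))
    (hq : Differentiable ℝ q) (hq' : Differentiable ℝ (deriv q))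
    (hq0 : ∀ t, q t ≠ 0)
    (s : ℝ → ℝ) (hs : Differentiable ℝ s)
    (heq : ∀ t, m • deriv (deriv q) t
      = -((γ * m) • deriv q t) - (deriv U ‖q t‖ / ‖q t‖) • q t)
    (heqs : ∀ t, deriv s t = (1/2) * m * ‖deriv q t‖ ^ 2 - U ‖q t‖ - γ * s t)
    (E : ℝ → ℝ)
    (hE : ∀ t, E t = (1/2) * m * ‖deriv q t‖ ^ 2 + U ‖q t‖ + γ * s t) :
    ∀ t, deriv E t = -γ * E t := by
  intro t
  have hv := (hq' t).hasDerivAt.norm_sq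
  have hr := hasDerivAt_norm_of_ne_zero (hq t).hasDerivAt (hq0 t)
  have hUr := ((hU.differentiable one_ne_zero) ‖q t‖).hasDerivAt.comp t hr
  have hE' := ((hv.const_mul ((1 / 2) * m)).add hUr).add ((hs t).hasDerivAt.const_mul γ)
  have hpower := congrArg (inner ℝ (deriv q t)) (heq t)
  simp only [inner_sub_right, inner_neg_right, inner_smul_right, real_inner_self_eq_norm_sq]
    at hpower
  rw [real_inner_comm (q t) (deriv q t)] at hpower
  rw [(funext hE : E = _)]
  refine hE'.deriv.trans ?_
  rw [heqs t]
  linear_combination hpower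
end

section
/- Dissipation law for the rotational symmetry of two coupled damped vibrating strings: let γ ∈ ℝ and c : ℝ² → ℝ. Suppose q¹, q² : ℝ² → ℝ are C² functions of (t, x) satisfying the coupled damped string equations ∂²q^a/∂t² + ∂²q^a/∂x² + γ ∂q^a/∂t + c(t,x) q^a = 0 for a = 1, 2. Then the quantities F^t = q¹ ∂q²/∂t − q² ∂q¹/∂t and F^x = q¹ ∂q²/∂x − q² ∂q¹/∂x satisfy the dissipation law ∂F^t/∂t + ∂F^x/∂x = −γ F^t at every point of ℝ². -/
/-- The derivative of the Wronskian of two `C²` functions along a direction `v`, in that same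
direction: the first-order terms cancel. -/
theorem fderiv_wronskian_apply {E : Type*} [NormedAddCommGroup E] [NormedSpace ℝ E]
    {f g : E → ℝ} (hf : ContDiff ℝ 2 f) (hg : ContDiff ℝ 2 g) (v z : E) :
    fderiv ℝ (fun w => f w * fderiv ℝ g w v - g w * fderiv ℝ f w v) z v
      = f z * fderiv ℝ (fun w => fderiv ℝ g w v) z v
        - g z * fderiv ℝ (fun w => fderiv ℝ f w v) z v := by
  have hasFDerivAt_self {h : E → ℝ} (hh : ContDiff ℝ 2 h) : HasFDerivAt h (fderiv ℝ h z) z :=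
    (hh.differentiable (by norm_num) z).hasFDerivAt
  have hasFDerivAt_dir {h : E → ℝ} (hh : ContDiff ℝ 2 h) :
      HasFDerivAt (fun w => fderiv ℝ h w v) (fderiv ℝ (fun w => fderiv ℝ h w v) z) z :=
    (((hh.fderiv_right (m := 1) (by norm_num)).clm_apply contDiff_const).differentiable
      (by norm_num) z).hasFDerivAt
  have key := ((hasFDerivAt_self hf).mul (hasFDerivAt_dir hg)).sub
    ((hasFDerivAt_self hg).mul (hasFDerivAt_dir hf))
  refine (DFunLike.congr_fun key.fderiv v).trans ?_
  simp only [sub_apply, add_apply, smul_apply, smul_eq_mul]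
  ring

/-- **Dissipation law for the rotational symmetry of two coupled damped
vibrating strings**: if `q¹, q²` satisfy
`q^a_tt + q^a_xx + γ q^a_t + c q^a = 0`, then
`F^t = q¹ q²_t − q² q¹_t` and `F^x = q¹ q²_x − q² q¹_x` satisfy the
dissipation law `∂F^t/∂t + ∂F^x/∂x = −γ F^t`. -/
theorem coupled_strings_dissipation_law (γ : ℝ) (c : ℝ × ℝ → ℝ)
    (q₁ q₂ : ℝ × ℝ → ℝ) (hq₁ : ContDiff ℝ 2 q₁) (hq₂ : ContDiff ℝ 2 q₂)
    (heq₁ : ∀ z, fderiv ℝ (fun w => fderiv ℝ q₁ w (1, 0)) z (1, 0)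
      + fderiv ℝ (fun w => fderiv ℝ q₁ w (0, 1)) z (0, 1)
      + γ * fderiv ℝ q₁ z (1, 0) + c z * q₁ z = 0)
    (heq₂ : ∀ z, fderiv ℝ (fun w => fderiv ℝ q₂ w (1, 0)) z (1, 0)
      + fderiv ℝ (fun w => fderiv ℝ q₂ w (0, 1)) z (0, 1)
      + γ * fderiv ℝ q₂ z (1, 0) + c z * q₂ z = 0)
    (Ft Fx : ℝ × ℝ → ℝ)
    (hFt : ∀ z, Ft z = q₁ z * fderiv ℝ q₂ z (1, 0) - q₂ z * fderiv ℝ q₁ z (1, 0))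
    (hFx : ∀ z, Fx z = q₁ z * fderiv ℝ q₂ z (0, 1) - q₂ z * fderiv ℝ q₁ z (0, 1)) :
    ∀ z, fderiv ℝ Ft z (1, 0) + fderiv ℝ Fx z (0, 1) = -γ * Ft z := by
  intro z
  rw [funext hFt, funext hFx, fderiv_wronskian_apply hq₁ hq₂, fderiv_wronskian_apply hq₁ hq₂]
  linear_combination q₁ z * heq₂ z - q₂ z * heq₁ z
end

section
/- Burgers' equation as a contactification of the heat equation: let k ≠ 0 and γ = −1/k. Suppose u : ℝ² → ℝ is C², v, p, q : ℝ² → ℝ are C¹, and σ, ς : ℝ² → ℝ are functions of (t, x) satisfying the Hamilton–De Donder–Weyl equations of the 2-contact Hamiltonian system (M, η^t, η^x, H) with H = −(1/k) p q + γ u ς, namely: ∂v/∂t − ∂p/∂x = γ(ς + u p), −∂u/∂t − ∂q/∂x = γ u q, ∂u/∂x = −q/k, and ∂v/∂x = −p/k at every point. Then u satisfies Burgers' equation: ∂u/∂t + u ∂u/∂x = k ∂²u/∂x². -/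
/-- **Burgers' equation as a contactification of the heat equation**: with
`γ = −1/k`, any solution `(u, v, p, q, σ, ς)` of the Hamilton–De Donder–Weyl
equations of the 2-contact Hamiltonian system with `H = −(1/k)pq + γuς`,
namely `v_t − p_x = γ(ς + up)`, `−u_t − q_x = γuq`, `u_x = −q/k`,
`v_x = −p/k`, has `u` satisfying Burgers' equation `u_t + u u_x = k u_xx`. -/
theorem burgers_contactification_of_heat (k γ : ℝ) (hk : k ≠ 0)
    (hγ : γ = -1 / k)
    (u : ℝ × ℝ → ℝ) (hu : ContDiff ℝ 2 u)
    (v p q : ℝ × ℝ → ℝ)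
    (hv : ContDiff ℝ 1 v) (hp : ContDiff ℝ 1 p) (hq : ContDiff ℝ 1 q)
    (σ ς : ℝ × ℝ → ℝ)
    (heq1 : ∀ z, fderiv ℝ v z (1, 0) - fderiv ℝ p z (0, 1)
      = γ * (ς z + u z * p z))
    (heq2 : ∀ z, -fderiv ℝ u z (1, 0) - fderiv ℝ q z (0, 1)
      = γ * (u z * q z))
    (heq3 : ∀ z, fderiv ℝ u z (0, 1) = -(q z) / k)
    (heq4 : ∀ z, fderiv ℝ v z (0, 1) = -(p z) / k) :
    ∀ z, fderiv ℝ u z (1, 0) + u z * fderiv ℝ u z (0, 1)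
      = k * fderiv ℝ (fun w => fderiv ℝ u w (0, 1)) z (0, 1) := by
  intro z
  have hqd : DifferentiableAt ℝ q z := hq.differentiable one_ne_zero z
  have hux : (fun w => fderiv ℝ u w (0, 1)) = fun w => (-1 / k) * q w := by
    funext w
    rw [heq3 w]
    ring
  have huxx : k * fderiv ℝ (fun w => fderiv ℝ u w (0, 1)) z (0, 1)
      = -fderiv ℝ q z (0, 1) := by
    rw [hux, fderiv_const_mul hqd, smul_apply, smul_eq_mul]
    field_simp
  have hut := heq2 z
  rw [huxx, heq3 z]
  rw [hγ] at hut
  linear_combination -hut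
end

section
/- Damped Klein–Gordon and the telegrapher's equation from the 4-contact Euler–Lagrange equations: let m, γ₀, γ₁, γ₂, γ₃ ∈ ℝ and define L : ℝ × ℝ⁴ × ℝ⁴ → ℝ by L(q, v₀, v₁, v₂, v₃, s⁰, s¹, s², s³) = (1/2)(v₀² − v₁² − v₂² − v₃²) − (1/2) m² q² + Σ_μ γ_μ s^μ. Let φ : ℝ⁴ → ℝ be C² and s⁰,…,s³ : ℝ⁴ → ℝ be any functions, and let ψ = (φ, ∂₀φ, ∂₁φ, ∂₂φ, ∂₃φ, s⁰, s¹, s², s³) be the prolongation. Then the second-order 4-contact Euler–Lagrange equation Σ_α ∂_α[(∂L/∂v_α)∘ψ] = [∂L/∂q + Σ_α (∂L/∂s^α)(∂L/∂v_α)]∘ψ holds at every point if and only if φ satisfies the damped Klein–Gordon equation (□ + m² − γ₀ ∂₀ + γ₁ ∂₁ + γ₂ ∂₂ + γ₃ ∂₃) φ = 0, where □φ = ∂₀²φ − ∂₁²φ − ∂₂²φ − ∂₃²φ. In particular, for (γ₀, γ₁, γ₂, γ₃) = (−γ, 0, 0, 0) this is the telegrapher's equation □φ + γ ∂₀φ +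 m² φ = 0. -/
open scoped BigOperators

/-- The contactified Klein–Gordon Lagrangian
`L(q, v₀, v₁, v₂, v₃, s⁰, s¹, s², s³)
  = (1/2)(v₀² − v₁² − v₂² − v₃²) − (1/2)m²q² + Σ_μ γ_μ s^μ`. -/
noncomputable def kgLagrangian (m : ℝ) (γv : Fin 4 → ℝ) :
    ℝ × (Fin 4 → ℝ) × (Fin 4 → ℝ) → ℝ :=
  fun w => (1/2) * ((w.2.1 0) ^ 2 - (w.2.1 1) ^ 2 - (w.2.1 2) ^ 2 - (w.2.1 3) ^ 2)
    - (1/2) * m ^ 2 * w.1 ^ 2 + ∑ μ, γv μ * w.2.2 μ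

/-- The derivative of the contactified Klein–Gordon Lagrangian at `w` in the direction `u`. -/
theorem fderiv_kgLagrangian_apply (m : ℝ) (γv : Fin 4 → ℝ)
    (w u : ℝ × (Fin 4 → ℝ) × (Fin 4 → ℝ)) :
    fderiv ℝ (kgLagrangian m γv) w u =
      w.2.1 0 * u.2.1 0 - w.2.1 1 * u.2.1 1 - w.2.1 2 * u.2.1 2 - w.2.1 3 * u.2.1 3
        - m ^ 2 * w.1 * u.1 + ∑ μ, γv μ * u.2.2 μ := by
  have hd : DifferentiableAt ℝ (kgLagrangian m γv) w := by
    unfold kgLagrangian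
    fun_prop
  have hline : HasDerivAt (fun t : ℝ => w + t • u) u 0 := by
    simpa using ((hasDerivAt_id (0 : ℝ)).smul_const u).const_add w
  have hcomp : HasDerivAt (fun t : ℝ => kgLagrangian m γv (w + t • u))
      (fderiv ℝ (kgLagrangian m γv) w u) 0 :=
    hd.hasFDerivAt.comp_hasDerivAt_of_eq (0 : ℝ) hline (by simp)
  have hcoord (a b : ℝ) : HasDerivAt (fun t : ℝ => a + t * b) b 0 := by
    simpa using ((hasDerivAt_id (0 : ℝ)).mul_const b).const_add a
  have hsq (a b : ℝ) : HasDerivAt (fun t : ℝ => (a + t * b) ^ 2) (2 * a * b) 0 := by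
    simpa using (hcoord a b).fun_pow 2
  have hexplicit := (((((hsq (w.2.1 0) (u.2.1 0)).fun_sub (hsq (w.2.1 1) (u.2.1 1))).fun_sub
    (hsq (w.2.1 2) (u.2.1 2))).fun_sub (hsq (w.2.1 3) (u.2.1 3))).const_mul (1 / 2)).fun_sub
    ((hsq w.1 u.1).const_mul (1 / 2 * m ^ 2)) |>.fun_add
    (HasDerivAt.fun_sum (u := Finset.univ) fun μ _ =>
      (hcoord (w.2.2 μ) (u.2.2 μ)).const_mul (γv μ))
  rw [hcomp.unique hexplicit]
  ring

/-- **Damped Klein–Gordon (telegrapher's) equation from the 4-contact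
Euler–Lagrange equations**: for a `C²` field `φ` with prolongation
`ψ = (φ, ∂₀φ, ∂₁φ, ∂₂φ, ∂₃φ, s⁰, …, s³)`, the 4-contact Euler–Lagrange
equation `Σ_α ∂_α[(∂L/∂v_α)∘ψ] = [∂L/∂q + Σ_α (∂L/∂s^α)(∂L/∂v_α)]∘ψ` holds
at every point iff `φ` satisfies the damped Klein–Gordon equation
`(□ + m² − γ₀∂₀ + γ₁∂₁ + γ₂∂₂ + γ₃∂₃)φ = 0`; in particular, for
`γ = (−γ₀, 0, 0, 0)` this is the telegrapher's equation. -/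
theorem damped_klein_gordon_telegrapher (m : ℝ) (γv : Fin 4 → ℝ)
    (φ : (Fin 4 → ℝ) → ℝ) (hφ : ContDiff ℝ 2 φ)
    (s : (Fin 4 → ℝ) → Fin 4 → ℝ)
    (ψ : (Fin 4 → ℝ) → ℝ × (Fin 4 → ℝ) × (Fin 4 → ℝ))
    (hψ : ∀ z, ψ z = (φ z, fun α => fderiv ℝ φ z (Pi.single α (1:ℝ)), s z)) :
    (∀ z, (∑ α, fderiv ℝ
          (fun w => fderiv ℝ (kgLagrangian m γv) (ψ w) (0, Pi.single α (1:ℝ), 0))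
          z (Pi.single α (1:ℝ)))
        = fderiv ℝ (kgLagrangian m γv) (ψ z) (1, 0, 0)
          + ∑ α, fderiv ℝ (kgLagrangian m γv) (ψ z) (0, 0, Pi.single α (1:ℝ))
              * fderiv ℝ (kgLagrangian m γv) (ψ z) (0, Pi.single α (1:ℝ), 0))
    ↔ (∀ z,
        (fderiv ℝ (fun w => fderiv ℝ φ w (Pi.single 0 (1:ℝ))) z (Pi.single 0 (1:ℝ))
          - fderiv ℝ (fun w => fderiv ℝ φ w (Pi.single 1 (1:ℝ))) z (Pi.single 1 (1:ℝ))
          - fderiv ℝ (fun w => fderiv ℝ φ w (Pi.single 2 (1:ℝ))) z (Pi.single 2 (1:ℝ))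
          - fderiv ℝ (fun w => fderiv ℝ φ w (Pi.single 3 (1:ℝ))) z (Pi.single 3 (1:ℝ)))
        + m ^ 2 * φ z
        - γv 0 * fderiv ℝ φ z (Pi.single 0 (1:ℝ))
        + γv 1 * fderiv ℝ φ z (Pi.single 1 (1:ℝ))
        + γv 2 * fderiv ℝ φ z (Pi.single 2 (1:ℝ))
        + γv 3 * fderiv ℝ φ z (Pi.single 3 (1:ℝ)) = 0) := by
  refine forall_congr' fun z => ?_
  simp only [fderiv_kgLagrangian_apply, hψ, Fin.sum_univ_four]
  simp
  constructor <;> intro h <;> linarith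
end

section
/- Damped electromagnetic waves from Maxwell's equations with dissipation: let μ₀, ε₀ > 0, c = 1/√(μ₀ε₀), and γ₀ ∈ ℝ. Let E, B : ℝ × ℝ³ → ℝ³ be C² fields of (t, x) satisfying the dissipative source-free Maxwell equations: div E = 0, div B = 0, curl E = −∂B/∂t, and curl B = μ₀ ε₀ ∂E/∂t + (γ₀/c) E, where div F = ∂₁F₁ + ∂₂F₂ + ∂₃F₃ and curl F = (∂₂F₃ − ∂₃F₂, ∂₃F₁ − ∂₁F₃, ∂₁F₂ − ∂₂F₁) are taken in the spatial variables. Then both fields satisfy the damped wave equation: ∂²E/∂t² − c² ΔE + c γ₀ ∂E/∂t = 0 and ∂²B/∂t² − c² ΔB + c γ₀ ∂B/∂t = 0 componentwise, where Δ is the spatial Laplacian Δ = ∂₁² + ∂₂² + ∂₃². -/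
open scoped BigOperators

/-- Spatial partial derivative `∂ᵢ F` of a scalar field `F` of `(t, x)`. -/
noncomputable def spatialDeriv (F : ℝ × (Fin 3 → ℝ) → ℝ) (i : Fin 3)
    (z : ℝ × (Fin 3 → ℝ)) : ℝ :=
  fderiv ℝ F z (0, Pi.single i (1:ℝ))

/-- Time derivative `∂F/∂t` of a scalar field `F` of `(t, x)`. -/
noncomputable def timeDeriv (F : ℝ × (Fin 3 → ℝ) → ℝ)
    (z : ℝ × (Fin 3 → ℝ)) : ℝ :=
  fderiv ℝ F z (1, 0)

/-- Spatial divergence `div F = ∂₁F₁ + ∂₂F₂ + ∂₃F₃` of a vector field of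
`(t, x)`. -/
noncomputable def spatialDiv (F : ℝ × (Fin 3 → ℝ) → Fin 3 → ℝ)
    (z : ℝ × (Fin 3 → ℝ)) : ℝ :=
  ∑ i, spatialDeriv (fun w => F w i) i z

/-- Spatial curl `curl F = (∂₂F₃ − ∂₃F₂, ∂₃F₁ − ∂₁F₃, ∂₁F₂ − ∂₂F₁)` of a
vector field of `(t, x)` (indices `0,1,2` in place of `1,2,3`). -/
noncomputable def spatialCurl (F : ℝ × (Fin 3 → ℝ) → Fin 3 → ℝ)
    (z : ℝ × (Fin 3 → ℝ)) : Fin 3 → ℝ :=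
  ![spatialDeriv (fun w => F w 2) 1 z - spatialDeriv (fun w => F w 1) 2 z,
    spatialDeriv (fun w => F w 0) 2 z - spatialDeriv (fun w => F w 2) 0 z,
    spatialDeriv (fun w => F w 1) 0 z - spatialDeriv (fun w => F w 0) 1 z]

/-- The spatial Laplacian `Δf = ∂₁²f + ∂₂²f + ∂₃²f` of a scalar field of `(t, x)`. -/
noncomputable def spatialLaplacian (f : ℝ × (Fin 3 → ℝ) → ℝ) (z : ℝ × (Fin 3 → ℝ)) : ℝ :=
  ∑ i, spatialDeriv (fun w => spatialDeriv f i w) i z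

section DirectionalDerivative

variable {V : Type*} [NormedAddCommGroup V] [NormedSpace ℝ V] {f : V → ℝ}

lemma ContDiff.differentiable_fderiv_apply_const (hf : ContDiff ℝ 2 f) (v : V) :
    Differentiable ℝ fun w => fderiv ℝ f w v :=
  ((hf.fderiv_right (m := 1) (by norm_num)).differentiable one_ne_zero).clm_apply
    (differentiable_const v)

lemma ContDiff.fderiv_fderiv_apply_comm (hf : ContDiff ℝ 2 f) (u v z : V) :
    fderiv ℝ (fun w => fderiv ℝ f w u) z v = fderiv ℝ (fun w => fderiv ℝ f w v) z u := by
  have hd : DifferentiableAt ℝ (fderiv ℝ f) z :=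
    (hf.fderiv_right (m := 1) (by norm_num)).differentiable one_ne_zero z
  have hsymm : IsSymmSndFDerivAt ℝ f z := hf.contDiffAt.isSymmSndFDerivAt (by simp)
  rw [fderiv_clm_apply hd (differentiableAt_const u),
    fderiv_clm_apply hd (differentiableAt_const v)]
  simpa using hsymm.eq v u

end DirectionalDerivative

section ScalarField

variable {f g : ℝ × (Fin 3 → ℝ) → ℝ} {z : ℝ × (Fin 3 → ℝ)}

lemma ContDiff.differentiable_spatialDeriv (hf : ContDiff ℝ 2 f) (i : Fin 3) :
    Differentiable ℝ fun w => spatialDeriv f i w :=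
  hf.differentiable_fderiv_apply_const _

lemma ContDiff.differentiable_timeDeriv (hf : ContDiff ℝ 2 f) :
    Differentiable ℝ fun w => timeDeriv f w :=
  hf.differentiable_fderiv_apply_const _

lemma spatialDeriv_comm (hf : ContDiff ℝ 2 f) (i j : Fin 3) (z : ℝ × (Fin 3 → ℝ)) :
    spatialDeriv (fun w => spatialDeriv f i w) j z =
      spatialDeriv (fun w => spatialDeriv f j w) i z :=
  hf.fderiv_fderiv_apply_comm _ _ _

lemma timeDeriv_spatialDeriv (hf : ContDiff ℝ 2 f) (i : Fin 3) (z : ℝ × (Fin 3 → ℝ)) :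
    timeDeriv (fun w => spatialDeriv f i w) z = spatialDeriv (fun w => timeDeriv f w) i z :=
  hf.fderiv_fderiv_apply_comm _ _ _

lemma spatialDeriv_add (hf : DifferentiableAt ℝ f z) (hg : DifferentiableAt ℝ g z) (i : Fin 3) :
    spatialDeriv (fun w => f w + g w) i z = spatialDeriv f i z + spatialDeriv g i z := by
  simp [spatialDeriv, fderiv_fun_add hf hg]

lemma spatialDeriv_sub (hf : DifferentiableAt ℝ f z) (hg : DifferentiableAt ℝ g z) (i : Fin 3) :
    spatialDeriv (fun w => f w - g w) i z = spatialDeriv f i z - spatialDeriv g i z := by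
  simp [spatialDeriv, fderiv_fun_sub hf hg]

lemma spatialDeriv_const_mul (hf : DifferentiableAt ℝ f z) (a : ℝ) (i : Fin 3) :
    spatialDeriv (fun w => a * f w) i z = a * spatialDeriv f i z := by
  simp [spatialDeriv, fderiv_const_mul hf]

lemma timeDeriv_add (hf : DifferentiableAt ℝ f z) (hg : DifferentiableAt ℝ g z) :
    timeDeriv (fun w => f w + g w) z = timeDeriv f z + timeDeriv g z := by
  simp [timeDeriv, fderiv_fun_add hf hg]

lemma timeDeriv_sub (hf : DifferentiableAt ℝ f z) (hg : DifferentiableAt ℝ g z) :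
    timeDeriv (fun w => f w - g w) z = timeDeriv f z - timeDeriv g z := by
  simp [timeDeriv, fderiv_fun_sub hf hg]

lemma timeDeriv_neg : timeDeriv (fun w => -f w) z = -timeDeriv f z := by
  simp [timeDeriv]

lemma timeDeriv_const_mul (hf : DifferentiableAt ℝ f z) (a : ℝ) :
    timeDeriv (fun w => a * f w) z = a * timeDeriv f z := by
  simp [timeDeriv, fderiv_const_mul hf]

end ScalarField

section VectorField

variable {F G : ℝ × (Fin 3 → ℝ) → Fin 3 → ℝ}

/-- The identity `curl curl F = grad (div F) - ΔF` for `C²` fields. -/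
lemma spatialCurl_spatialCurl (hF : ContDiff ℝ 2 F) (z : ℝ × (Fin 3 → ℝ)) (j : Fin 3) :
    spatialCurl (fun w => spatialCurl F w) z j =
      spatialDeriv (fun w => spatialDiv F w) j z - spatialLaplacian (fun w => F w j) z := by
  have hC (k : Fin 3) : ContDiff ℝ 2 fun w => F w k := contDiff_pi.1 hF k
  have hD (k i : Fin 3) : DifferentiableAt ℝ (fun w => spatialDeriv (fun w => F w k) i w) z :=
    (hC k).differentiable_spatialDeriv i z
  have hcurl (a b k l i : Fin 3) :
      spatialDeriv (fun w => spatialDeriv (fun w => F w a) k w -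
        spatialDeriv (fun w => F w b) l w) i z =
      spatialDeriv (fun w => spatialDeriv (fun w => F w a) k w) i z -
        spatialDeriv (fun w => spatialDeriv (fun w => F w b) l w) i z :=
    spatialDeriv_sub (hD a k) (hD b l) i
  have hdiv : spatialDeriv (fun w => spatialDiv F w) j z =
      spatialDeriv (fun w => spatialDeriv (fun w => F w 0) 0 w) j z +
      spatialDeriv (fun w => spatialDeriv (fun w => F w 1) 1 w) j z +
      spatialDeriv (fun w => spatialDeriv (fun w => F w 2) 2 w) j z := by
    simp only [spatialDiv, Fin.sum_univ_three]
    rw [spatialDeriv_add ((hD 0 0).fun_add (hD 1 1)) (hD 2 2),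
      spatialDeriv_add (hD 0 0) (hD 1 1)]
  rw [hdiv, spatialLaplacian, Fin.sum_univ_three]
  fin_cases j <;>
    simp only [spatialCurl, Fin.zero_eta, Fin.mk_one, Fin.reduceFinMk, Matrix.cons_val, hcurl]
  · rw [spatialDeriv_comm (hC 1) 1 0, spatialDeriv_comm (hC 2) 2 0]
    ring
  · rw [spatialDeriv_comm (hC 0) 0 1, spatialDeriv_comm (hC 2) 2 1]
    ring
  · rw [spatialDeriv_comm (hC 0) 0 2, spatialDeriv_comm (hC 1) 1 2]
    ring

lemma spatialCurl_spatialCurl_of_spatialDiv_eq_zero (hF : ContDiff ℝ 2 F)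
    (hdiv : ∀ z, spatialDiv F z = 0) (z : ℝ × (Fin 3 → ℝ)) (j : Fin 3) :
    spatialCurl (fun w => spatialCurl F w) z j = -spatialLaplacian (fun w => F w j) z := by
  rw [spatialCurl_spatialCurl hF]
  simp [hdiv, spatialDeriv]

lemma timeDeriv_spatialCurl (hF : ContDiff ℝ 2 F) (z : ℝ × (Fin 3 → ℝ)) (j : Fin 3) :
    timeDeriv (fun w => spatialCurl F w j) z =
      spatialCurl (fun w k => timeDeriv (fun w => F w k) w) z j := by
  have hC (k : Fin 3) : ContDiff ℝ 2 fun w => F w k := contDiff_pi.1 hF k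
  have hcurl (a b k l : Fin 3) :
      timeDeriv (fun w => spatialDeriv (fun w => F w a) k w -
        spatialDeriv (fun w => F w b) l w) z =
      spatialDeriv (fun w => timeDeriv (fun w => F w a) w) k z -
        spatialDeriv (fun w => timeDeriv (fun w => F w b) w) l z := by
    rw [timeDeriv_sub ((hC a).differentiable_spatialDeriv k z)
      ((hC b).differentiable_spatialDeriv l z), timeDeriv_spatialDeriv (hC a),
      timeDeriv_spatialDeriv (hC b)]
  fin_cases j <;>
    simp only [spatialCurl, Fin.zero_eta, Fin.mk_one, Fin.reduceFinMk, Matrix.cons_val, hcurl]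

lemma spatialCurl_const_mul_add_const_mul {z : ℝ × (Fin 3 → ℝ)}
    (hF : ∀ k, DifferentiableAt ℝ (fun w => F w k) z)
    (hG : ∀ k, DifferentiableAt ℝ (fun w => G w k) z) (a b : ℝ) (j : Fin 3) :
    spatialCurl (fun w k => a * F w k + b * G w k) z j =
      a * spatialCurl F z j + b * spatialCurl G z j := by
  have hlin (k i : Fin 3) : spatialDeriv (fun w => a * F w k + b * G w k) i z =
      a * spatialDeriv (fun w => F w k) i z + b * spatialDeriv (fun w => G w k) i z := by
    rw [spatialDeriv_add ((hF k).const_mul a) ((hG k).const_mul b),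
      spatialDeriv_const_mul (hF k), spatialDeriv_const_mul (hG k)]
  fin_cases j <;>
    simp only [spatialCurl, Fin.zero_eta, Fin.mk_one, Fin.reduceFinMk, Matrix.cons_val, hlin] <;>
    ring

lemma spatialCurl_neg (z : ℝ × (Fin 3 → ℝ)) (j : Fin 3) :
    spatialCurl (fun w k => -F w k) z j = -spatialCurl F z j := by
  have hneg (k i : Fin 3) :
      spatialDeriv (fun w => -F w k) i z = -spatialDeriv (fun w => F w k) i z := by
    simp [spatialDeriv]
  fin_cases j <;>
    simp only [spatialCurl, Fin.zero_eta, Fin.mk_one, Fin.reduceFinMk, Matrix.cons_val, hneg] <;>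
    ring

end VectorField

/-- **Damped electromagnetic waves from Maxwell's equations with dissipation**:
if `C²` fields `E, B` satisfy the dissipative source-free Maxwell equations
`div E = 0`, `div B = 0`, `curl E = −∂B/∂t`,
`curl B = μ₀ε₀ ∂E/∂t + (γ₀/c) E`, then both satisfy the damped wave equation
`∂²F/∂t² − c²ΔF + cγ₀ ∂F/∂t = 0` componentwise. -/
theorem damped_electromagnetic_waves (μ₀ ε₀ γ₀ c : ℝ)
    (hμ : 0 < μ₀) (hε : 0 < ε₀) (hc : c = 1 / Real.sqrt (μ₀ * ε₀))
    (E B : ℝ × (Fin 3 → ℝ) → Fin 3 → ℝ)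
    (hE : ContDiff ℝ 2 E) (hB : ContDiff ℝ 2 B)
    (hdivE : ∀ z, spatialDiv E z = 0)
    (hdivB : ∀ z, spatialDiv B z = 0)
    (hcurlE : ∀ z j, spatialCurl E z j = -timeDeriv (fun w => B w j) z)
    (hcurlB : ∀ z j, spatialCurl B z j
      = μ₀ * ε₀ * timeDeriv (fun w => E w j) z + (γ₀ / c) * E z j) :
    (∀ z j, timeDeriv (fun w => timeDeriv (fun w' => E w' j) w) z
        - c ^ 2 * (∑ i, spatialDeriv (fun w => spatialDeriv (fun w' => E w' j) i w) i z)
        + c * γ₀ * timeDeriv (fun w => E w j) z = 0)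
    ∧ (∀ z j, timeDeriv (fun w => timeDeriv (fun w' => B w' j) w) z
        - c ^ 2 * (∑ i, spatialDeriv (fun w => spatialDeriv (fun w' => B w' j) i w) i z)
        + c * γ₀ * timeDeriv (fun w => B w j) z = 0) := by
  have hμε : 0 < μ₀ * ε₀ := mul_pos hμ hε
  have hc0 : c ≠ 0 := by
    rw [hc]
    positivity
  have hc2 : c ^ 2 * (μ₀ * ε₀) = 1 := by
    rw [hc, div_pow, Real.sq_sqrt hμε.le]
    field_simp
  have hcγ : c ^ 2 * (γ₀ / c) = c * γ₀ := by
    field_simp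
  have hEC (k : Fin 3) : ContDiff ℝ 2 fun w => E w k := contDiff_pi.1 hE k
  have hED (k : Fin 3) : Differentiable ℝ fun w => E w k := (hEC k).differentiable two_ne_zero
  have hcurlE' : (fun w => spatialCurl E w) = fun w k => -timeDeriv (fun w => B w k) w :=
    funext fun w => funext (hcurlE w)
  have hcurlB' : (fun w => spatialCurl B w) =
      fun w k => μ₀ * ε₀ * timeDeriv (fun w => E w k) w + γ₀ / c * E w k :=
    funext fun w => funext (hcurlB w)
  refine ⟨fun z j => ?_, fun z j => ?_⟩
  · have h := spatialCurl_spatialCurl_of_spatialDiv_eq_zero hE hdivE z j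
    rw [hcurlE', spatialCurl_neg, ← timeDeriv_spatialCurl hB] at h
    simp only [hcurlB] at h
    rw [timeDeriv_add (((hEC j).differentiable_timeDeriv z).const_mul _)
      ((hED j z).const_mul _), timeDeriv_const_mul ((hEC j).differentiable_timeDeriv z),
      timeDeriv_const_mul (hED j z), spatialLaplacian] at h
    linear_combination -c ^ 2 * h -
      timeDeriv (fun w => timeDeriv (fun w' => E w' j) w) z * hc2 -
      timeDeriv (fun w => E w j) z * hcγ
  · have h := spatialCurl_spatialCurl_of_spatialDiv_eq_zero hB hdivB z j
    rw [hcurlB', spatialCurl_const_mul_add_const_mul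
      (fun k => (hEC k).differentiable_timeDeriv z) (fun k => hED k z),
      ← timeDeriv_spatialCurl hE, hcurlE] at h
    simp only [hcurlE] at h
    rw [timeDeriv_neg, spatialLaplacian] at h
    linear_combination -c ^ 2 * h -
      timeDeriv (fun w => timeDeriv (fun w' => B w' j) w) z * hc2 -
      timeDeriv (fun w => B w j) z * hcγ
end
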